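/- Let q ≡ 3 (mod 4) be a prime power and let r ∈ 𝔽_q[t] be an irreducible polynomial with gcd(r, t(t−1)) = 1. Then there do NOT exist natural numbers h₁, h₂ with h₁ < 4·deg r and h₂ < 4·deg r together with quadruples a = (a₁,a₂,a₃,a₄) and b = (b₁,b₂,b₃,b₄) in 𝔽_q[t]⁴ such that: a₁² + a₂² − (t−1)(a₃² + a₄²) = t^{h₁}, r divides each of a₂, a₃, a₄, (t−1) divides a₁ − 1, (t−1) divides a₂, and (a₃, a₄) ≠ (0,0); and simultaneously b₁² + b₂² − (t−1)(b₃² + b₄²) = t^{h₂}, r divides each of b₁, b₃, b₄, (t−1) divides b₁ − 1, and (t−1) divides b₂. -/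

import Mathlib

open Polynomial
open scoped Classical

section SumOfTwoSquares

variable {F : Type*} [Field F]

theorem eq_zero_of_sq_add_sq_eq_zero (hF : ¬ IsSquare (-1 : F)) {x y : F}
    (h : x ^ 2 + y ^ 2 = 0) : x = 0 ∧ y = 0 := by
  have hy : y = 0 := by
    by_contra hy
    refine hF ⟨x / y, ?_⟩
    field_simp
    linear_combination -h
  refine ⟨?_, hy⟩
  simpa [hy] using h

theorem natDegree_sq_add_sq (hF : ¬ IsSquare (-1 : F)) (P Q : F[X]) :
    (P ^ 2 + Q ^ 2).natDegree = 2 * max P.natDegree Q.natDegree := by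
  set n := max P.natDegree Q.natDegree with hn
  have hP : P.natDegree ≤ n := le_max_left _ _
  have hQ : Q.natDegree ≤ n := le_max_right _ _
  have hle : (P ^ 2 + Q ^ 2).natDegree ≤ 2 * n :=
    natDegree_add_le_of_degree_le (natDegree_pow_le_of_le 2 hP) (natDegree_pow_le_of_le 2 hQ)
  refine le_antisymm hle ?_
  rcases Nat.eq_zero_or_pos n with h0 | hpos
  · simp [h0]
  refine le_natDegree_of_ne_zero fun h ↦ ?_
  rw [coeff_add, coeff_pow_of_natDegree_le hP, coeff_pow_of_natDegree_le hQ] at h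
  obtain ⟨hp, hq⟩ := eq_zero_of_sq_add_sq_eq_zero hF h
  rcases max_choice P.natDegree Q.natDegree with hm | hm
  · rw [hn, hm, coeff_natDegree, leadingCoeff_eq_zero] at hp
    rw [← hn] at hm
    simp [hp] at hm
    omega
  · rw [hn, hm, coeff_natDegree, leadingCoeff_eq_zero] at hq
    rw [← hn] at hm
    simp [hq] at hm
    omega

theorem sq_add_sq_eq_zero_iff (hF : ¬ IsSquare (-1 : F)) {P Q : F[X]} :
    P ^ 2 + Q ^ 2 = 0 ↔ P = 0 ∧ Q = 0 := by
  refine ⟨fun h ↦ ?_, fun ⟨hP, hQ⟩ ↦ by simp [hP, hQ]⟩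
  have hdeg := natDegree_sq_add_sq hF P Q
  rw [h, natDegree_zero] at hdeg
  have hP : P.natDegree = 0 := by omega
  have hQ : Q.natDegree = 0 := by omega
  rw [eq_C_of_natDegree_eq_zero hP, eq_C_of_natDegree_eq_zero hQ] at h ⊢
  simp only [← C_pow, ← C_add, C_eq_zero] at h ⊢
  exact eq_zero_of_sq_add_sq_eq_zero hF h

theorem natDegree_X_sub_one_mul_sq_add_sq (hF : ¬ IsSquare (-1 : F)) {P Q : F[X]}
    (h : ¬(P = 0 ∧ Q = 0)) :
    ((X - 1) * (P ^ 2 + Q ^ 2)).natDegree = 2 * max P.natDegree Q.natDegree + 1 := by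
  rw [← C_1, natDegree_mul (X_sub_C_ne_zero 1) (mt (sq_add_sq_eq_zero_iff hF).1 h),
    natDegree_sq_add_sq hF, natDegree_X_sub_C, add_comm]

theorem two_mul_natDegree_le_of_quaternary_form_eq (hF : ¬ IsSquare (-1 : F))
    {A B C D : F[X]} {h : ℕ}
    (heq : A ^ 2 + B ^ 2 - (X - 1) * (C ^ 2 + D ^ 2) = X ^ h) :
    2 * A.natDegree ≤ h ∧ 2 * B.natDegree ≤ h := by
  suffices (A ^ 2 + B ^ 2).natDegree ≤ h by
    rw [natDegree_sq_add_sq hF] at this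
    omega
  by_cases hCD : C = 0 ∧ D = 0
  · obtain ⟨rfl, rfl⟩ := hCD
    have : A ^ 2 + B ^ 2 = X ^ h := by linear_combination heq
    rw [this, natDegree_X_pow]
  have hodd := natDegree_X_sub_one_mul_sq_add_sq hF hCD
  have heven := natDegree_sq_add_sq hF A B
  have hh : (X ^ h : F[X]).natDegree = h := natDegree_X_pow h
  rw [← heq] at hh
  rcases lt_or_ge (A ^ 2 + B ^ 2).natDegree ((X - 1) * (C ^ 2 + D ^ 2)).natDegree with hlt | hge
  · rw [natDegree_sub_eq_right_of_natDegree_lt hlt] at hh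
    omega
  · rw [natDegree_sub_eq_left_of_natDegree_lt (by omega)] at hh
    omega

theorem eq_or_eq_neg_of_sq_dvd_sq_sub_sq (h2 : (2 : F) ≠ 0) {r P Q : F[X]} (hr : Irreducible r)
    (hQ : ¬ r ∣ Q) (hdP : P.natDegree < 2 * r.natDegree) (hdQ : Q.natDegree < 2 * r.natDegree)
    (h : r ^ 2 ∣ P ^ 2 - Q ^ 2) : P = Q ∨ P = -Q := by
  have hdeg : (r ^ 2).natDegree = 2 * r.natDegree := natDegree_pow r 2
  rw [sq_sub_sq] at h
  by_cases hs : r ∣ P + Q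
  · have hd : ¬ r ∣ P - Q := fun hd ↦ by
      have h2Q : r ∣ C 2 * Q := by
        have := dvd_sub hs hd
        rwa [show P + Q - (P - Q) = C 2 * Q by rw [C_ofNat]; ring] at this
      rcases hr.prime.dvd_or_dvd h2Q with hu | hu
      · exact hr.not_isUnit (isUnit_of_dvd_unit hu (isUnit_C.2 h2.isUnit))
      · exact hQ hu
    have := (((hr.coprime_iff_not_dvd).2 hd).pow_left (m := 2)).dvd_of_dvd_mul_right h
    right
    refine eq_neg_of_add_eq_zero_left (eq_zero_of_dvd_of_natDegree_lt this ?_)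
    have := natDegree_add_le P Q
    omega
  · have := (((hr.coprime_iff_not_dvd).2 hs).pow_left (m := 2)).dvd_of_dvd_mul_left h
    left
    refine sub_eq_zero.1 (eq_zero_of_dvd_of_natDegree_lt this ?_)
    have := natDegree_sub_le P Q
    omega

end SumOfTwoSquares

/-- **Diameter lower bound, non-bipartite case (key diophantine step).**
If `q ≡ 3 (mod 4)` and `r ∈ 𝔽_q[t]` is irreducible and coprime to `t(t−1)`, then there are
no natural numbers `h₁, h₂ < 4·deg r` and quadruples `a, b ∈ 𝔽_q[t]⁴` with
`a₁² + a₂² − (t−1)(a₃² + a₄²) = t^{h₁}`, `r ∣ a₂, a₃, a₄`, `(t−1) ∣ a₁ − 1`, `(t−1) ∣ a₂`,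
`(a₃,a₄) ≠ (0,0)`, and `b₁² + b₂² − (t−1)(b₃² + b₄²) = t^{h₂}`, `r ∣ b₁, b₃, b₄`,
`(t−1) ∣ b₁ − 1`, `(t−1) ∣ b₂`. -/
theorem stmt_2 (Fq : Type) [Field Fq] [Fintype Fq] (hq : Fintype.card Fq % 4 = 3)
    (r : Polynomial Fq) (hrirr : Irreducible r)
    (hrcop : IsCoprime r (Polynomial.X * (Polynomial.X - 1))) :
    ¬ ∃ (h₁ h₂ : ℕ) (a₁ a₂ a₃ a₄ b₁ b₂ b₃ b₄ : Polynomial Fq),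
      h₁ < 4 * r.natDegree ∧ h₂ < 4 * r.natDegree ∧
      a₁ ^ 2 + a₂ ^ 2 - (Polynomial.X - 1) * (a₃ ^ 2 + a₄ ^ 2) = Polynomial.X ^ h₁ ∧
      r ∣ a₂ ∧ r ∣ a₃ ∧ r ∣ a₄ ∧
      (Polynomial.X - 1) ∣ (a₁ - 1) ∧ (Polynomial.X - 1) ∣ a₂ ∧
      ¬(a₃ = 0 ∧ a₄ = 0) ∧
      b₁ ^ 2 + b₂ ^ 2 - (Polynomial.X - 1) * (b₃ ^ 2 + b₄ ^ 2) = Polynomial.X ^ h₂ ∧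
      r ∣ b₁ ∧ r ∣ b₃ ∧ r ∣ b₄ ∧
      (Polynomial.X - 1) ∣ (b₁ - 1) ∧ (Polynomial.X - 1) ∣ b₂ := by
  rintro ⟨h₁, h₂, a₁, a₂, a₃, a₄, b₁, b₂, b₃, b₄, hh₁, hh₂, ha, hra₂, hra₃, hra₄, hta₁, -,
    hne, hb, hrb₁, hrb₃, hrb₄, -, htb₂⟩
  have hF : ¬ IsSquare (-1 : Fq) := fun h ↦ FiniteField.isSquare_neg_one_iff.1 h hq
  have h2 : (2 : Fq) ≠ 0 := fun h ↦ hF ⟨1, by linear_combination -h⟩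
  have hrX : ¬ r ∣ (X : Fq[X]) := fun h ↦
    hrirr.not_isUnit (hrcop.isUnit_of_dvd' dvd_rfl (h.mul_right _))
  have hrXpow (k : ℕ) : ¬ r ∣ (X : Fq[X]) ^ k := fun h ↦ hrX (hrirr.prime.dvd_of_dvd_pow h)
  obtain ⟨hda₁, -⟩ := two_mul_natDegree_le_of_quaternary_form_eq hF ha
  obtain ⟨-, hdb₂⟩ := two_mul_natDegree_le_of_quaternary_form_eq hF hb
  have hea₁ : a₁.eval 1 = 1 := by
    rw [← C_1, dvd_iff_isRoot, IsRoot, eval_sub, eval_C] at hta₁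
    linear_combination hta₁
  have heb₂ : b₂.eval 1 = 0 := by
    rwa [← C_1, dvd_iff_isRoot] at htb₂
  have hma : r ^ 2 ∣ a₁ ^ 2 - X ^ h₁ := by
    obtain ⟨⟨u, rfl⟩, ⟨v, rfl⟩, ⟨w, rfl⟩⟩ := And.intro hra₂ (And.intro hra₃ hra₄)
    exact ⟨(X - 1) * (v ^ 2 + w ^ 2) - u ^ 2, by linear_combination ha⟩
  have hmb : r ^ 2 ∣ b₂ ^ 2 - X ^ h₂ := by
    obtain ⟨⟨u, rfl⟩, ⟨v, rfl⟩, ⟨w, rfl⟩⟩ := And.intro hrb₁ (And.intro hrb₃ hrb₄)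
    exact ⟨(X - 1) * (v ^ 2 + w ^ 2) - u ^ 2, by linear_combination hb⟩
  have hr : r ∣ r ^ 2 := dvd_pow_self r two_ne_zero
  have hra₁ : ¬ r ∣ a₁ := fun h ↦ hrXpow h₁ <|
    (dvd_sub_right (h.trans (dvd_pow_self a₁ two_ne_zero))).1 (hr.trans hma)
  have hrb₂ : ¬ r ∣ b₂ := fun h ↦ hrXpow h₂ <|
    (dvd_sub_right (h.trans (dvd_pow_self b₂ two_ne_zero))).1 (hr.trans hmb)
  rcases Nat.even_or_odd' h₁ with ⟨k, rfl | rfl⟩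
  · have hsq : a₁ ^ 2 = (X ^ k) ^ 2 := sq_eq_sq_iff_eq_or_eq_neg.2 <|
      eq_or_eq_neg_of_sq_dvd_sq_sub_sq h2 hrirr (hrXpow k) (by omega)
        (by rw [natDegree_X_pow]; omega) (by rwa [← pow_mul, mul_comm k])
    have heq : a₂ ^ 2 + 0 ^ 2 = (X - 1) * (a₃ ^ 2 + a₄ ^ 2) := by
      linear_combination ha - hsq
    have hodd := natDegree_X_sub_one_mul_sq_add_sq hF hne
    rw [← heq, natDegree_sq_add_sq hF] at hodd
    omega
  rcases Nat.even_or_odd' h₂ with ⟨l, rfl | rfl⟩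
  · have hsq : b₂ ^ 2 = (X ^ l) ^ 2 := sq_eq_sq_iff_eq_or_eq_neg.2 <|
      eq_or_eq_neg_of_sq_dvd_sq_sub_sq h2 hrirr (hrXpow l) (by omega)
        (by rw [natDegree_X_pow]; omega) (by rwa [← pow_mul, mul_comm l])
    simpa [heb₂] using congrArg (eval 1) hsq
  rcases le_total k l with hkl | hkl
  · obtain ⟨m, rfl⟩ := Nat.exists_eq_add_of_le hkl
    have hsq : b₂ ^ 2 = (a₁ * X ^ m) ^ 2 := by
      refine sq_eq_sq_iff_eq_or_eq_neg.2 <| eq_or_eq_neg_of_sq_dvd_sq_sub_sq h2 hrirr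
        (fun h ↦ (hrirr.prime.dvd_or_dvd h).elim hra₁ (hrXpow m)) (by omega) ?_ ?_
      · have := natDegree_mul_le (p := a₁) (q := X ^ m)
        rw [natDegree_X_pow] at this
        omega
      · convert dvd_sub hmb (hma.mul_right (X ^ (2 * m))) using 1
        ring
    simpa [heb₂, hea₁] using congrArg (eval 1) hsq
  · obtain ⟨m, rfl⟩ := Nat.exists_eq_add_of_le hkl
    have hsq : a₁ ^ 2 = (b₂ * X ^ m) ^ 2 := by
      refine sq_eq_sq_iff_eq_or_eq_neg.2 <| eq_or_eq_neg_of_sq_dvd_sq_sub_sq h2 hrirr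
        (fun h ↦ (hrirr.prime.dvd_or_dvd h).elim hrb₂ (hrXpow m)) (by omega) ?_ ?_
      · have := natDegree_mul_le (p := b₂) (q := X ^ m)
        rw [natDegree_X_pow] at this
        omega
      · convert dvd_sub hma (hmb.mul_right (X ^ (2 * m))) using 1
        ring
    simpa [heb₂, hea₁] using congrArg (eval 1) hsq
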